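/- Under Assumption 1, if the optimal value V(x_0) is finite for every x_0 ∈ ℝ^n with x_0 ≥ 0, then there exists p ∈ ℝ^n with p ≥ 0 satisfying the fixed-point equation p = s + A^T p + Σ_{i=1}^n min{r_i + B_i^T p, 0} E_i (i.e., p = T(p)). -/

import Mathlib

open Matrix Finset

/-- `minZero v` is the minimum of the entries of `v` and of the scalar `0`. -/
noncomputable def minZero {k : ℕ} (v : Fin k → ℝ) : ℝ :=
  (insert (0 : ℝ) (Finset.image v Finset.univ)).min' (Finset.insert_nonempty _ _)

/-- The Bellman operator `T(p) = s + Aᵀ p + Σ_i min{r_i + B_iᵀ p, 0} E_i`. -/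
noncomputable def bellman {n : ℕ} {m : Fin n → ℕ}
    (A : Matrix (Fin n) (Fin n) ℝ) (B : ∀ i, Matrix (Fin n) (Fin (m i)) ℝ)
    (s : Fin n → ℝ) (r : ∀ i, Fin (m i) → ℝ) (E : Matrix (Fin n) (Fin n) ℝ)
    (p : Fin n → ℝ) : Fin n → ℝ :=
  fun j => s j + (Aᵀ *ᵥ p) j +
    ∑ i, minZero (fun l => r i l + ((B i)ᵀ *ᵥ p) l) * E i j

/-- Membership in the set 𝒦 of blockwise nonnegative feedback matrices with
full (`1ᵀ K_i = E_iᵀ`) or zero (`1ᵀ K_i = 0`) actuation in each block. -/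
def memK {n : ℕ} {m : Fin n → ℕ} (E : Matrix (Fin n) (Fin n) ℝ)
    (K : ∀ i, Matrix (Fin (m i)) (Fin n) ℝ) : Prop :=
  ∀ i, (∀ l j, 0 ≤ K i l j) ∧
    ((∀ j, ∑ l, K i l j = E i j) ∨ (∀ j, ∑ l, K i l j = 0))

/-- Assumption 1: `(A + BK) x ≥ 0` for every `K ∈ 𝒦` and every `x ≥ 0`. -/
def assumption1 {n : ℕ} {m : Fin n → ℕ}
    (A : Matrix (Fin n) (Fin n) ℝ) (B : ∀ i, Matrix (Fin n) (Fin (m i)) ℝ)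
    (E : Matrix (Fin n) (Fin n) ℝ) : Prop :=
  ∀ K : ∀ i, Matrix (Fin (m i)) (Fin n) ℝ, memK E K →
    ∀ x : Fin n → ℝ, 0 ≤ x → 0 ≤ (A + ∑ i, B i * K i) *ᵥ x

/-- The constraint set `U(x) = {u : u ≥ 0, 1ᵀ u_i ≤ E_iᵀ x for all i}`. -/
def inputSet {n : ℕ} {m : Fin n → ℕ} (E : Matrix (Fin n) (Fin n) ℝ)
    (x : Fin n → ℝ) : Set (∀ i, Fin (m i) → ℝ) :=
  {u | ∀ i, (∀ l, 0 ≤ u i l) ∧ (∑ l, u i l) ≤ ∑ j, E i j * x j}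

/-- An admissible trajectory from `x0`: `x(0) = x0`, `u(t) ∈ U(x(t))` and
`x(t+1) = A x(t) + B u(t)`. -/
def admissible {n : ℕ} {m : Fin n → ℕ}
    (A : Matrix (Fin n) (Fin n) ℝ) (B : ∀ i, Matrix (Fin n) (Fin (m i)) ℝ)
    (E : Matrix (Fin n) (Fin n) ℝ) (x0 : Fin n → ℝ)
    (x : ℕ → Fin n → ℝ) (u : ℕ → ∀ i, Fin (m i) → ℝ) : Prop :=
  x 0 = x0 ∧ ∀ t, u t ∈ inputSet E (x t) ∧
    x (t + 1) = A *ᵥ x t + ∑ i, (B i) *ᵥ (u t i)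

/-- The state trajectory generated by a control sequence `u` from `x0`. -/
noncomputable def traj {n : ℕ} {m : Fin n → ℕ}
    (A : Matrix (Fin n) (Fin n) ℝ) (B : ∀ i, Matrix (Fin n) (Fin (m i)) ℝ)
    (x0 : Fin n → ℝ) (u : ℕ → ∀ i, Fin (m i) → ℝ) : ℕ → Fin n → ℝ
  | 0 => x0
  | t + 1 => A *ᵥ traj A B x0 u t + ∑ i, (B i) *ᵥ (u t i)

/-- Total cost `Σ_{t=0}^∞ [sᵀ x(t) + rᵀ u(t)] ∈ [0,∞]` of a trajectory. -/
noncomputable def trajCost {n : ℕ} {m : Fin n → ℕ}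
    (s : Fin n → ℝ) (r : ∀ i, Fin (m i) → ℝ)
    (x : ℕ → Fin n → ℝ) (u : ℕ → ∀ i, Fin (m i) → ℝ) : ENNReal :=
  ∑' t, ENNReal.ofReal ((∑ j, s j * x t j) + ∑ i, ∑ l, r i l * u t i l)

/-- Optimal value `V(x0)`: infimum of the total cost over admissible trajectories. -/
noncomputable def optValue {n : ℕ} {m : Fin n → ℕ}
    (A : Matrix (Fin n) (Fin n) ℝ) (B : ∀ i, Matrix (Fin n) (Fin (m i)) ℝ)
    (E : Matrix (Fin n) (Fin n) ℝ) (s : Fin n → ℝ) (r : ∀ i, Fin (m i) → ℝ)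
    (x0 : Fin n → ℝ) : ENNReal :=
  ⨅ (x : ℕ → Fin n → ℝ) (u : ℕ → ∀ i, Fin (m i) → ℝ)
    (_ : admissible A B E x0 x u), trajCost s r x u

/-- The spectral radius of `M` is strictly less than `1`. -/
def schurStable {n : ℕ} (M : Matrix (Fin n) (Fin n) ℝ) : Prop :=
  ∀ μ ∈ spectrum ℂ (M.map Complex.ofReal), ‖μ‖ < 1

open Filter Topology

lemma minZero_eq_inf' {k : ℕ} (v : Fin k → ℝ) :
    minZero v = Finset.univ.inf' Finset.univ_nonempty (fun o : Option (Fin k) => o.elim 0 v) := by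
  apply le_antisymm
  · refine Finset.le_inf' _ _ fun o _ => Finset.min'_le _ _ ?_
    cases o <;> simp
  · refine Finset.le_min' _ _ _ fun y hy => ?_
    rcases Finset.mem_insert.mp hy with rfl | hy
    · exact Finset.inf'_le (fun o : Option (Fin k) => o.elim 0 v) (Finset.mem_univ none)
    · obtain ⟨l, -, rfl⟩ := Finset.mem_image.mp hy
      exact Finset.inf'_le (fun o : Option (Fin k) => o.elim 0 v) (Finset.mem_univ (some l))

lemma minZero_le_elim {k : ℕ} (v : Fin k → ℝ) (o : Option (Fin k)) :
    minZero v ≤ o.elim 0 v := by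
  rw [minZero_eq_inf']
  exact Finset.inf'_le (fun o : Option (Fin k) => o.elim 0 v) (Finset.mem_univ o)

lemma minZero_nonpos {k : ℕ} (v : Fin k → ℝ) : minZero v ≤ 0 :=
  minZero_le_elim v none

lemma minZero_le {k : ℕ} (v : Fin k → ℝ) (l : Fin k) : minZero v ≤ v l :=
  minZero_le_elim v (some l)

lemma exists_minZero_eq {k : ℕ} (v : Fin k → ℝ) :
    ∃ o : Option (Fin k), minZero v = o.elim 0 v := by
  obtain ⟨o, -, ho⟩ := Finset.exists_mem_eq_inf' Finset.univ_nonempty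
    (fun o : Option (Fin k) => o.elim 0 v)
  exact ⟨o, (minZero_eq_inf' v).trans ho⟩

lemma minZero_eq_zero {k : ℕ} {v : Fin k → ℝ} (hv : ∀ l, 0 ≤ v l) : minZero v = 0 := by
  obtain ⟨o, ho⟩ := exists_minZero_eq v
  refine le_antisymm (minZero_nonpos v) (ho ▸ ?_)
  cases o
  · exact le_rfl
  · exact hv _

lemma continuous_minZero {k : ℕ} : Continuous (minZero : (Fin k → ℝ) → ℝ) := by
  rw [funext minZero_eq_inf']
  refine Continuous.finset_inf'_apply _ fun o _ => ?_
  cases o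
  · exact continuous_const
  · exact continuous_apply _

section Bellman

variable {n : ℕ} {m : Fin n → ℕ}
  {A : Matrix (Fin n) (Fin n) ℝ} {B : ∀ i, Matrix (Fin n) (Fin (m i)) ℝ}
  {s : Fin n → ℝ} {r : ∀ i, Fin (m i) → ℝ} {E : Matrix (Fin n) (Fin n) ℝ}

lemma continuous_bellman : Continuous (bellman A B s r E) := by
  refine continuous_pi fun j => ?_
  unfold bellman
  refine Continuous.add (by fun_prop) (continuous_finsetSum _ fun i _ => ?_)
  refine Continuous.mul (continuous_minZero.comp ?_) continuous_const
  fun_prop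

lemma bellman_zero (hr : ∀ i l, 0 ≤ r i l) : bellman A B s r E 0 = s := by
  ext j
  have h : ∀ i, minZero (fun l => r i l) = 0 := fun i => minZero_eq_zero (hr i)
  simp [bellman, h]

/-- Selecting in each block either one input or none yields a nonnegative closed-loop matrix. -/
lemma closedLoop_nonneg (hE : ∀ i j, 0 ≤ E i j) (hA1 : assumption1 A B E)
    (g : ∀ i, Option (Fin (m i))) (a j : Fin n) :
    0 ≤ A a j + ∑ i, (g i).elim 0 (fun l => B i a l) * E i j := by
  have hK : memK E (fun i => Matrix.of fun l j => if g i = some l then E i j else 0) := by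
    intro i
    refine ⟨fun l j => ?_, ?_⟩
    · simp only [Matrix.of_apply]
      split_ifs
      exacts [hE i j, le_rfl]
    · cases h : g i with
      | none => right; simp [h]
      | some l => left; simp [h]
  have h := hA1 _ hK (Pi.single j 1) (by simp) a
  have hB : ∀ i, ∑ l, B i a l * (if g i = some l then E i j else 0) =
      (g i).elim 0 (fun l => B i a l) * E i j := by
    intro i
    cases h : g i <;> simp
  simpa only [Pi.zero_apply, Matrix.mulVec_single_one, Matrix.col_apply, Matrix.add_apply,
    Matrix.sum_apply, Matrix.mul_apply, Matrix.of_apply, hB] using h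

lemma bellman_mono (hE : ∀ i j, 0 ≤ E i j) (hA1 : assumption1 A B E) :
    Monotone (bellman A B s r E) := by
  intro p q hpq j
  choose g hg using fun i => exists_minZero_eq (fun l => r i l + ((B i)ᵀ *ᵥ q) l)
  have hdiff : ∀ i, (g i).elim 0 (fun l => r i l + ((B i)ᵀ *ᵥ q) l) =
      (g i).elim 0 (fun l => r i l + ((B i)ᵀ *ᵥ p) l) +
        ∑ a, (g i).elim 0 (fun l => B i a l) * (q a - p a) := by
    intro i
    cases g i with
    | none => simp
    | some l =>
      simp only [Option.elim_some, Matrix.mulVec, dotProduct, Matrix.transpose_apply,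
        mul_sub, Finset.sum_sub_distrib]
      ring
  have hnonneg : 0 ≤ ∑ a, (A a j + ∑ i, (g i).elim 0 (fun l => B i a l) * E i j) *
      (q a - p a) :=
    Finset.sum_nonneg fun a _ =>
      mul_nonneg (closedLoop_nonneg hE hA1 g a j) (sub_nonneg.mpr (hpq a))
  have hsplit : ∑ a, (A a j + ∑ i, (g i).elim 0 (fun l => B i a l) * E i j) * (q a - p a) =
      (Aᵀ *ᵥ q) j - (Aᵀ *ᵥ p) j +
        ∑ i, (∑ a, (g i).elim 0 (fun l => B i a l) * (q a - p a)) * E i j := by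
    simp only [add_mul, Finset.sum_add_distrib, Finset.sum_mul]
    rw [Finset.sum_comm]
    congr 1
    · simp [Matrix.mulVec, dotProduct, mul_sub]
    · exact Finset.sum_congr rfl fun i _ => Finset.sum_congr rfl fun a _ => by ring
  have hle : ∑ i, minZero (fun l => r i l + ((B i)ᵀ *ᵥ p) l) * E i j ≤
      ∑ i, (g i).elim 0 (fun l => r i l + ((B i)ᵀ *ᵥ p) l) * E i j :=
    Finset.sum_le_sum fun i _ => mul_le_mul_of_nonneg_right (minZero_le_elim _ _) (hE i j)
  simp only [bellman, hg, hdiff, add_mul, Finset.sum_add_distrib]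
  linarith

/-- The Bellman operator is a lower bound for the cost-to-go of any admissible input. -/
lemma bellman_dotProduct_le (p x : Fin n → ℝ) {u : ∀ i, Fin (m i) → ℝ}
    (hu : u ∈ inputSet E x) :
    bellman A B s r E p ⬝ᵥ x ≤
      (∑ j, s j * x j + ∑ i, ∑ l, r i l * u i l) + p ⬝ᵥ (A *ᵥ x + ∑ i, B i *ᵥ u i) := by
  have hblock : ∀ i, minZero (fun l => r i l + ((B i)ᵀ *ᵥ p) l) * ∑ j, E i j * x j ≤
      ∑ l, r i l * u i l + p ⬝ᵥ (B i *ᵥ u i) := by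
    intro i
    have hBu : p ⬝ᵥ (B i *ᵥ u i) = ∑ l, ((B i)ᵀ *ᵥ p) l * u i l := by
      rw [Matrix.dotProduct_mulVec, ← Matrix.mulVec_transpose]
      rfl
    rw [hBu, ← Finset.sum_add_distrib]
    calc _ ≤ minZero (fun l => r i l + ((B i)ᵀ *ᵥ p) l) * ∑ l, u i l :=
          mul_le_mul_of_nonpos_left (hu i).2 (minZero_nonpos _)
      _ ≤ _ := by
          rw [Finset.mul_sum]
          refine Finset.sum_le_sum fun l _ => ?_
          rw [← add_mul]
          exact mul_le_mul_of_nonneg_right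
            (minZero_le (fun l => r i l + ((B i)ᵀ *ᵥ p) l) l) ((hu i).1 l)
  have hsum := Finset.sum_le_sum fun i (_ : i ∈ Finset.univ) => hblock i
  have hA : ∑ j, (Aᵀ *ᵥ p) j * x j = p ⬝ᵥ (A *ᵥ x) := by
    rw [Matrix.dotProduct_mulVec, ← Matrix.mulVec_transpose]
    rfl
  have hT : bellman A B s r E p ⬝ᵥ x = ∑ j, s j * x j + p ⬝ᵥ (A *ᵥ x) +
      ∑ i, minZero (fun l => r i l + ((B i)ᵀ *ᵥ p) l) * ∑ j, E i j * x j := by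
    rw [← hA]
    simp only [dotProduct, bellman, add_mul, Finset.sum_add_distrib, Finset.sum_mul,
      Finset.mul_sum]
    rw [Finset.sum_comm (γ := Fin n)]
    simp only [mul_assoc]
  rw [Finset.sum_add_distrib] at hsum
  rw [hT, dotProduct_add, dotProduct_sum]
  linarith

lemma iterate_bellman_dotProduct_le (k : ℕ) {x : ℕ → Fin n → ℝ}
    {u : ℕ → ∀ i, Fin (m i) → ℝ} (hu : ∀ t, u t ∈ inputSet E (x t))
    (hx : ∀ t, x (t + 1) = A *ᵥ x t + ∑ i, B i *ᵥ u t i) (t : ℕ) :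
    (bellman A B s r E)^[k] 0 ⬝ᵥ x t ≤ ∑ τ ∈ Finset.range k,
      (∑ j, s j * x (t + τ) j + ∑ i, ∑ l, r i l * u (t + τ) i l) := by
  induction k generalizing t with
  | zero => simp
  | succ k ih =>
    rw [Function.iterate_succ_apply', Finset.sum_range_succ']
    refine (bellman_dotProduct_le _ _ (hu t)).trans ?_
    rw [← hx, add_comm]
    refine add_le_add ((ih (t + 1)).trans_eq ?_) le_rfl
    exact Finset.sum_congr rfl fun τ _ => by rw [add_right_comm, add_assoc]

lemma iterate_bellman_dotProduct_le_optValue (k : ℕ) (x0 : Fin n → ℝ) :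
    ENNReal.ofReal ((bellman A B s r E)^[k] 0 ⬝ᵥ x0) ≤ optValue A B E s r x0 := by
  refine le_iInf fun x => le_iInf fun u => le_iInf fun hxu => ?_
  have h := iterate_bellman_dotProduct_le (A := A) (B := B) (s := s) (r := r) k
    (fun t => (hxu.2 t).1) (fun t => (hxu.2 t).2) 0
  rw [hxu.1] at h
  simp only [zero_add] at h
  calc _ ≤ ENNReal.ofReal (∑ t ∈ Finset.range k,
        (∑ j, s j * x t j + ∑ i, ∑ l, r i l * u t i l)) := ENNReal.ofReal_le_ofReal h
    _ ≤ ∑ t ∈ Finset.range k,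
        ENNReal.ofReal (∑ j, s j * x t j + ∑ i, ∑ l, r i l * u t i l) :=
      Finset.le_sum_of_subadditive _ ENNReal.ofReal_zero.le (fun _ _ => ENNReal.ofReal_add_le) _ _
    _ ≤ _ := ENNReal.sum_le_tsum _

end Bellman

/-- under Assumption 1, if the optimal value `V(x0)` is finite for
every `x0 ≥ 0`, then there is a nonnegative fixed point `p = T(p)`. -/
theorem stmt_3 {n : ℕ} {m : Fin n → ℕ}
    (A : Matrix (Fin n) (Fin n) ℝ) (B : ∀ i, Matrix (Fin n) (Fin (m i)) ℝ)
    (s : Fin n → ℝ) (r : ∀ i, Fin (m i) → ℝ) (E : Matrix (Fin n) (Fin n) ℝ)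
    (hs : ∀ j, 0 < s j) (hr : ∀ i l, 0 ≤ r i l)
    (hE : ∀ i j, 0 ≤ E i j) (hEinv : IsUnit E.det)
    (hA1 : assumption1 A B E)
    (hfin : ∀ x0 : Fin n → ℝ, 0 ≤ x0 → optValue A B E s r x0 ≠ ⊤) :
    ∃ p : Fin n → ℝ, 0 ≤ p ∧ p = bellman A B s r E p := by
  let p : ℕ → Fin n → ℝ := fun k => (bellman A B s r E)^[k] 0
  have hmono : Monotone p :=
    (bellman_mono hE hA1).monotone_iterate_of_le_map
      (by rw [bellman_zero hr]; exact fun j => (hs j).le)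
  have hbdd : ∀ j, BddAbove (Set.range fun k => p k j) := by
    intro j
    refine ⟨(optValue A B E s r (Pi.single j 1)).toReal, ?_⟩
    rintro _ ⟨k, rfl⟩
    have h := iterate_bellman_dotProduct_le_optValue (A := A) (B := B) (s := s) (r := r)
      (E := E) k (Pi.single j 1)
    rw [dotProduct_single_one] at h
    exact (ENNReal.ofReal_le_iff_le_toReal (hfin _ (by simp))).mp h
  have hlim : Tendsto p atTop (𝓝 fun j => ⨆ k, p k j) :=
    tendsto_pi_nhds.mpr fun j => tendsto_atTop_ciSup (fun _ _ h => hmono h j) (hbdd j)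
  refine ⟨fun j => ⨆ k, p k j, fun j => le_ciSup (hbdd j) 0, ?_⟩
  exact (isFixedPt_of_tendsto_iterate hlim continuous_bellman.continuousAt).symm
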